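/- Let p_1 < p_2 be distinct odd primes with p_1 ∤ (p_2 - 1), q coprime to p_1 p_2, and suppose o_{p_1^m}(q) = φ(p_1^m)/δ_1 and o_{p_2^ℓ}(q) = φ(p_2^ℓ)/δ_2 with δ_1 = p_1^{i_0^{(1)}-1} δ_1', δ_2 = p_2^{i_0^{(2)}-1} δ_2', gcd(δ_1', p_1) = gcd(δ_2', p_2) = 1. Then for all k coprime to p_1^m p_2^ℓ and all 1 ≤ j_1 ≤ m, 1 ≤ j_2 ≤ ℓ, the sum Σ_{i=0}^{o-1} ζ^{k q^i} (where ζ is a primitive p_1^{j_1} p_2^{j_2}-th root of unity in ℂ and o = o_{p_1^{j_1} p_2^{j_2}}(q)) vanishes if and only if j_1 > i_0^{(1)} or j_2 > i_0^{(2)}. -/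

import Mathlib

open Finset

lemma aux_lte (p : ℕ) (hp : p.Prime) (hodd : Odd p) (g i e : ℕ) (hi : 1 ≤ i)
    (h : (g : ZMod (p ^ (i + e))) ^ (p ^ e) = 1) : (g : ZMod (p ^ i)) = 1 := by
  have := Fact.mk hp
  have h1 : ((p ^ (i + e) : ℕ) : ℤ) ∣ (g : ℤ) ^ (p ^ e) - 1 ^ (p ^ e) := by
    rw [← ZMod.intCast_zmod_eq_zero_iff_dvd]
    push_cast
    rw [h]; simp
  have hgp : (g : ZMod p) = 1 := by
    have h2 : ((p : ℕ) : ℤ) ∣ (g : ℤ) ^ (p ^ e) - 1 ^ (p ^ e) :=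
      dvd_trans (by exact_mod_cast dvd_pow_self p (by omega)) h1
    rw [← ZMod.intCast_zmod_eq_zero_iff_dvd] at h2
    push_cast at h2
    rw [ZMod.pow_card_pow] at h2
    simpa [sub_eq_zero] using h2
  have h3 : ((p : ℕ) : ℤ) ∣ (g : ℤ) - 1 := by
    rw [← ZMod.intCast_zmod_eq_zero_iff_dvd]; push_cast; rw [hgp]; simp
  have h4 : ¬ ((p : ℕ) : ℤ) ∣ (g : ℤ) := by
    rw [← ZMod.intCast_zmod_eq_zero_iff_dvd]; push_cast; rw [hgp]; simp
  have h5 := Int.emultiplicity_pow_sub_pow hp hodd h3 h4 (p ^ e)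
  have h6 : emultiplicity p (p ^ e) = e :=
    emultiplicity_pow_self_of_prime hp.prime e
  push_cast at h1
  have h7 := le_emultiplicity_of_pow_dvd h1
  rw [h5, h6] at h7
  push_cast at h7
  have h8 : (i : ℕ∞) ≤ emultiplicity (p : ℤ) ((g : ℤ) - 1) :=
    (ENat.add_le_add_iff_right (ENat.natCast_ne_top e)).mp h7
  have h9 := pow_dvd_of_le_emultiplicity h8
  have h10 : ((p ^ i : ℕ) : ℤ) ∣ (g : ℤ) - 1 := by exact_mod_cast h9
  rw [← ZMod.intCast_zmod_eq_zero_iff_dvd] at h10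
  push_cast at h10
  exact sub_eq_zero.mp h10

/-- reduction -/
lemma aux_cast (a b g : ℕ) (h : a ∣ b) (hg : (g : ZMod b) = 1) : (g : ZMod a) = 1 := by
  have := congrArg (ZMod.castHom h (ZMod a)) hg
  rw [map_natCast, map_one] at this
  exact this

lemma aux_order_dvd (a b q : ℕ) (h : a ∣ b) :
    orderOf (q : ZMod a) ∣ orderOf (q : ZMod b) := by
  apply orderOf_dvd_of_pow_eq_one
  have := pow_orderOf_eq_one (q : ZMod b)
  have h2 := aux_cast a b (q ^ orderOf (q : ZMod b)) h (by push_cast; exact this)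
  exact_mod_cast h2

lemma aux_order_tot (n q : ℕ) (h : q.Coprime n) : orderOf (q : ZMod n) ∣ n.totient := by
  apply orderOf_dvd_of_pow_eq_one
  have := (ZMod.natCast_eq_natCast_iff (q ^ n.totient) 1 n).mpr (Nat.ModEq.pow_totient h)
  simpa using this

lemma aux_order_p (p q m j i0 δ δ' : ℕ) (hp : p.Prime) (hodd : Odd p)
    (hq : q.Coprime p) (hm : 1 ≤ m) (hj : 1 ≤ j) (hjm : j ≤ m) (hi0 : 1 ≤ i0)
    (ho : orderOf (q : ZMod (p ^ m)) * δ = Nat.totient (p ^ m))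
    (hδ : δ = p ^ (i0 - 1) * δ') (hδ' : δ'.Coprime p) :
    p ∣ orderOf (q : ZMod (p ^ j)) ↔ i0 < j := by
  set M := orderOf (q : ZMod (p ^ m)) with hM
  rw [Nat.totient_prime_pow hp (by omega), hδ] at ho
  have hpp : 0 < p := hp.pos
  have hpc : Nat.Coprime p (p - 1) := by
    rw [Nat.coprime_comm, Nat.coprime_self_sub_left hp.one_lt.le]; simp
  have him : i0 ≤ m := by
    have h1 : p ^ (i0 - 1) ∣ p ^ (m - 1) * (p - 1) := ⟨M * δ', by rw [← ho]; ring⟩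
    have h2 := (Nat.Coprime.pow_left (i0 - 1) hpc).dvd_of_dvd_mul_right h1
    have := (Nat.pow_dvd_pow_iff_le_right hp.one_lt).mp h2
    omega
  have hMe : M * δ' = p ^ (m - i0) * (p - 1) := by
    have : p ^ (i0 - 1) * (M * δ') = p ^ (i0 - 1) * (p ^ (m - i0) * (p - 1)) := by
      rw [← mul_assoc (p ^ (i0 - 1)) (p ^ (m - i0)), ← pow_add,
        show i0 - 1 + (m - i0) = m - 1 by omega, ← ho]; ring
    exact Nat.eq_of_mul_eq_mul_left (pow_pos hpp _) this
  have hMd : p ^ (m - i0) ∣ M :=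
    (Nat.Coprime.pow_left (m - i0) hδ'.symm).dvd_of_dvd_mul_right ⟨_, hMe⟩
  obtain ⟨M', hM'⟩ := hMd
  have hM'p : M' ∣ p - 1 := by
    refine ⟨δ', ?_⟩
    rw [hM', mul_assoc] at hMe
    exact (Nat.eq_of_mul_eq_mul_left (pow_pos hpp _) hMe).symm
  have hM'c : ¬ p ∣ M' := fun h => by
    have := Nat.eq_one_of_dvd_coprimes hpc dvd_rfl (h.trans hM'p)
    exact hp.one_lt.ne' this
  have hqM : (q : ZMod (p ^ m)) ^ M = 1 := pow_orderOf_eq_one _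
  constructor
  · intro h
    by_contra hlt
    push Not at hlt
    have h1 := aux_lte p hp hodd (q ^ M') i0 (m - i0) hi0 (by
      rw [show i0 + (m - i0) = m by omega]
      push_cast
      rw [← pow_mul, mul_comm, ← hM']; exact hqM)
    have h2 := aux_cast (p ^ j) (p ^ i0) _ (pow_dvd_pow p hlt) h1
    push_cast at h2
    exact hM'c (h.trans (orderOf_dvd_of_pow_eq_one h2))
  · intro h
    by_contra hnd
    set d := orderOf (q : ZMod (p ^ j)) with hd
    have h1 : (q : ZMod (p ^ j)) ^ d = 1 := pow_orderOf_eq_one _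
    have h2 : ((p ^ j : ℕ) : ℤ) ∣ (q : ℤ) ^ d - 1 := by
      rw [← ZMod.intCast_zmod_eq_zero_iff_dvd]; push_cast; rw [h1]; simp
    have hpj : ((p : ℕ) : ℤ) ∣ (q : ℤ) ^ d - 1 :=
      dvd_trans (by exact_mod_cast dvd_pow_self p (by omega)) h2
    have hpq : ¬ ((p : ℕ) : ℤ) ∣ (q : ℤ) ^ d := by
      intro h
      have := (Nat.prime_iff_prime_int.mp hp).dvd_of_dvd_pow h
      have h' : p ∣ q := by exact_mod_cast this
      exact hp.one_lt.ne' (Nat.eq_one_of_dvd_coprimes hq h' dvd_rfl)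
    have h5 := Int.emultiplicity_pow_sub_pow hp hodd hpj hpq (p ^ (m - j))
    rw [emultiplicity_pow_self_of_prime hp.prime, one_pow] at h5
    push_cast at h2
    have h6 := le_emultiplicity_of_pow_dvd h2
    have h7 : ((m : ℕ) : ℕ∞) ≤ emultiplicity (p : ℤ) (((q : ℤ) ^ d) ^ p ^ (m - j) - 1) := by
      rw [h5]
      calc ((m : ℕ) : ℕ∞) = (j : ℕ∞) + ((m - j : ℕ) : ℕ∞) := by
            rw [← Nat.cast_add]; congr 1; omega
        _ ≤ _ := by gcongr
    have h8 := pow_dvd_of_le_emultiplicity h7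
    have h9 : ((p ^ m : ℕ) : ℤ) ∣ ((q : ℤ) ^ d) ^ p ^ (m - j) - 1 := by exact_mod_cast h8
    rw [← ZMod.intCast_zmod_eq_zero_iff_dvd] at h9
    push_cast at h9
    rw [← pow_mul] at h9
    have h10 : M ∣ d * p ^ (m - j) := orderOf_dvd_of_pow_eq_one (sub_eq_zero.mp h9)
    have h11 : p ^ (m - i0) ∣ d * p ^ (m - j) := (Dvd.intro _ hM'.symm).trans h10
    have h12 := (Nat.Coprime.pow_left (m - i0)
      ((Nat.Prime.coprime_iff_not_dvd hp).mpr hnd)).dvd_of_dvd_mul_left h11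
    have := (Nat.pow_dvd_pow_iff_le_right hp.one_lt).mp h12
    omega

lemma aux_cop (p r l : ℕ) (hp : p.Prime) (hr : r.Prime) (hpr : p ≠ r) (hnd : ¬ p ∣ r - 1) :
    p.Coprime (Nat.totient (r ^ l)) := by
  rcases Nat.eq_zero_or_pos l with rfl | hl
  · simp
  rw [Nat.totient_prime_pow hr hl]
  exact Nat.Coprime.mul_right (Nat.Coprime.pow_right _ ((Nat.coprime_primes hp hr).mpr hpr))
    ((Nat.Prime.coprime_iff_not_dvd hp).mpr hnd)

lemma aux_char {n : ℕ} [NeZero n] {ζ : ℂ} (h : IsPrimitiveRoot ζ n) (a : ZMod n)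
    (ha : AddChar.zmodChar n h.pow_eq_one a = 1) : a = 0 := by
  rw [AddChar.zmodChar_apply, ← pow_zero ζ] at ha
  exact (ZMod.val_eq_zero a).mp (IsPrimitiveRoot.pow_inj h (ZMod.val_lt a) (NeZero.pos _) ha)

lemma aux_shift (F : ℕ → ℂ) (o c : ℕ) (h : ∀ i, F (i + o) = F i) :
    ∑ i ∈ range o, F (i + c) = ∑ i ∈ range o, F i := by
  induction c with
  | zero => simp
  | succ c ih =>
    rw [← ih]
    have h1 := sum_range_succ (fun i => F (i + c)) o
    have h2 := sum_range_succ' (fun i => F (i + c)) o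
    rw [h1] at h2
    have h3 : F (o + c) = F (0 + c) := by rw [add_comm o c, h]; simp
    rw [h3] at h2
    have := add_right_cancel h2
    rw [this]
    exact sum_congr rfl fun i _ => by congr 1; ring

lemma aux_pow {R : Type*} [CommRing R] (y : R) (hy : y * y = 0) (t : ℕ) :
    (1 + y) ^ t = 1 + t * y := by
  induction t with
  | zero => simp
  | succ t ih =>
    rw [pow_succ, ih]; push_cast; linear_combination (t : R) * hy

lemma aux_vanish (p r q k j l : ℕ) (hp : p.Prime) (hr : r.Prime) (hpr : p ≠ r) (hodd : Odd p)
    (hnd : ¬ p ∣ r - 1) (hqp : q.Coprime p) (hqr : q.Coprime r)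
    (hkp : k.Coprime p) (hkr : k.Coprime r) (hj : 2 ≤ j)
    (hpo : p ∣ orderOf (q : ZMod (p ^ j * r ^ l))) (ζ : ℂ)
    (hζ : IsPrimitiveRoot ζ (p ^ j * r ^ l)) :
    ∑ i ∈ range (orderOf (q : ZMod (p ^ j * r ^ l))), ζ ^ (k * q ^ i) = 0 := by
  set n := p ^ j * r ^ l with hn
  have hn0 : n ≠ 0 := by
    have := hp.pos; have := hr.pos; positivity
  have : NeZero n := ⟨hn0⟩
  set o := orderOf (q : ZMod n) with ho
  have hqn : q.Coprime n := Nat.Coprime.mul_right (hqp.pow_right _) (hqr.pow_right _)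
  have hkn : k.Coprime n := Nat.Coprime.mul_right (hkp.pow_right _) (hkr.pow_right _)
  have hqu : IsUnit (q : ZMod n) := (ZMod.isUnit_iff_coprime q n).mpr hqn
  have hku : IsUnit (k : ZMod n) := (ZMod.isUnit_iff_coprime k n).mpr hkn
  have ho0 : 0 < o := Nat.pos_of_dvd_of_pos (aux_order_tot n q hqn)
    (Nat.totient_pos.mpr (Nat.pos_of_ne_zero hn0))
  obtain ⟨o', ho'⟩ := hpo
  have hqo : (q : ZMod n) ^ o = 1 := pow_orderOf_eq_one _
  have hGp : ((q ^ o' : ℕ) : ZMod n) ^ p = 1 := by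
    push_cast; rw [← pow_mul, mul_comm, ← ho']; exact hqo
  have hG1 : ((q ^ o' : ℕ) : ZMod n) ≠ 1 := by
    push_cast
    intro h
    have h1 := Nat.le_of_dvd (Nat.pos_of_ne_zero (by rintro rfl; omega))
      (orderOf_dvd_of_pow_eq_one h)
    rw [← ho, ho'] at h1
    have h2 := hp.two_le
    have : 0 < o' := Nat.pos_of_ne_zero (by rintro rfl; omega)
    nlinarith
  have hGr : ((q ^ o' : ℕ) : ZMod (r ^ l)) = 1 := by
    rw [← orderOf_eq_one_iff]
    refine Nat.eq_one_of_dvd_coprimes (aux_cop p r l hp hr hpr hnd) ?_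
      (aux_order_tot _ _ ((hqr.pow_right l).pow_left o'))
    apply orderOf_dvd_of_pow_eq_one
    have := aux_cast (r ^ l) n ((q ^ o') ^ p) (Dvd.intro_left _ rfl) (by
      rw [Nat.cast_pow]; exact hGp)
    rw [Nat.cast_pow] at this; exact this
  have hGpj : ((q ^ o' : ℕ) : ZMod (p ^ (j - 1))) = 1 := by
    apply aux_lte p hp hodd (q ^ o') (j - 1) 1 (by omega)
    rw [show j - 1 + 1 = j by omega, pow_one]
    have := aux_cast (p ^ j) n ((q ^ o') ^ p) (Dvd.intro _ rfl) (by
      rw [Nat.cast_pow]; exact hGp)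
    rw [Nat.cast_pow] at this; exact this
  have hdiv : ((p : ℤ) ^ (j - 1) * (r : ℤ) ^ l) ∣ (q : ℤ) ^ o' - 1 := by
    apply IsCoprime.mul_dvd
    · have : Nat.Coprime (p ^ (j - 1)) (r ^ l) :=
        ((Nat.coprime_primes hp hr).mpr hpr).pow _ _
      exact_mod_cast (Nat.isCoprime_iff_coprime.mpr this)
    · have : ((p ^ (j - 1) : ℕ) : ℤ) ∣ (q : ℤ) ^ o' - 1 := by
        rw [← ZMod.intCast_zmod_eq_zero_iff_dvd]; push_cast
        push_cast at hGpj; rw [hGpj]; simp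
      exact_mod_cast this
    · have : ((r ^ l : ℕ) : ℤ) ∣ (q : ℤ) ^ o' - 1 := by
        rw [← ZMod.intCast_zmod_eq_zero_iff_dvd]; push_cast
        push_cast at hGr; rw [hGr]; simp
      exact_mod_cast this
  obtain ⟨c, hc⟩ := hdiv
  obtain ⟨y, hy⟩ : ∃ y : ZMod n, y = (q : ZMod n) ^ o' - 1 := ⟨_, rfl⟩
  have hyc : y = (((q : ℤ) ^ o' - 1 : ℤ) : ZMod n) := by rw [hy]; push_cast; rfl
  have hpy : (p : ZMod n) * y = 0 := by
    have : ((p : ℤ) * ((q : ℤ) ^ o' - 1) : ℤ) = ((n : ℕ) : ℤ) * c := by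
      rw [hc, hn, ← Nat.sub_add_cancel (show 1 ≤ j by omega)]; push_cast
      ring
    have h2 := congrArg (Int.cast : ℤ → ZMod n) this
    rw [hyc]
    push_cast at h2 ⊢
    rw [h2]; simp
  have hyy : y * y = 0 := by
    have : (((q : ℤ) ^ o' - 1) * ((q : ℤ) ^ o' - 1) : ℤ)
        = ((n : ℕ) : ℤ) * (c * c * (p : ℤ) ^ (j - 2) * (r : ℤ) ^ l) := by
      rw [hc, hn]
      obtain ⟨j, rfl⟩ := Nat.exists_eq_add_of_le' hj
      push_cast
      ring
    have h2 := congrArg (Int.cast : ℤ → ZMod n) this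
    rw [hyc, ← Int.cast_mul, h2]
    push_cast; simp
  have hy0 : y ≠ 0 := by
    intro h; apply hG1; push_cast; rw [h] at hy; exact (sub_eq_zero.mp hy.symm)
  have hqy : (q : ZMod n) ^ o' = 1 + y := by rw [hy]; ring
  set ψ := AddChar.zmodChar n hζ.pow_eq_one with hψ
  have hterm : ∀ i, ζ ^ (k * q ^ i) = ψ ((k : ZMod n) * (q : ZMod n) ^ i) := by
    intro i
    rw [hψ, ← AddChar.zmodChar_apply' hζ.pow_eq_one]; push_cast; rfl
  simp_rw [hterm]
  set S := ∑ i ∈ range o, ψ ((k : ZMod n) * (q : ZMod n) ^ i) with hS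
  have hshift : ∀ t, S = ∑ i ∈ range o,
      ψ ((k : ZMod n) * (q : ZMod n) ^ i) * ψ ((k : ZMod n) * (q : ZMod n) ^ i * y) ^ t := by
    intro t
    rw [hS, ← aux_shift (fun i => ψ ((k : ZMod n) * (q : ZMod n) ^ i)) o (o' * t) (by
      intro i; simp only [pow_add, hqo, mul_one])]
    refine sum_congr rfl fun i _ => ?_
    rw [← AddChar.map_nsmul_eq_pow, ← AddChar.map_add_eq_mul, pow_add, pow_mul, hqy,
      aux_pow y hyy, nsmul_eq_mul]
    congr 1; ring
  have hsum : (p : ℂ) * S = 0 := by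
    calc (p : ℂ) * S = ∑ t ∈ range p, S := by simp
      _ = ∑ t ∈ range p, ∑ i ∈ range o, ψ ((k : ZMod n) * (q : ZMod n) ^ i) *
            ψ ((k : ZMod n) * (q : ZMod n) ^ i * y) ^ t := sum_congr rfl fun t _ => hshift t
      _ = ∑ i ∈ range o, ψ ((k : ZMod n) * (q : ZMod n) ^ i) *
            ∑ t ∈ range p, ψ ((k : ZMod n) * (q : ZMod n) ^ i * y) ^ t := by
          rw [sum_comm]; simp_rw [mul_sum]
      _ = 0 := by
          refine sum_eq_zero fun i _ => ?_
          have hne : ψ ((k : ZMod n) * (q : ZMod n) ^ i * y) ≠ 1 := by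
            intro h
            have := aux_char hζ _ h
            exact hy0 (((hku.mul (hqu.pow i)).mul_right_eq_zero).mp this)
          have hpw : ψ ((k : ZMod n) * (q : ZMod n) ^ i * y) ^ p = 1 := by
            rw [← AddChar.map_nsmul_eq_pow, nsmul_eq_mul,
              show (p : ZMod n) * (k * (q : ZMod n) ^ i * y) = k * (q : ZMod n) ^ i * (p * y) by ring,
              hpy, mul_zero, AddChar.map_zero_eq_one]
          rw [geom_sum_eq hne, hpw]; simp
  exact (mul_eq_zero.mp hsum).resolve_left (by exact_mod_cast hp.ne_zero)

/-- some translate by a multiple of x leaves the orbit -/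
lemma aux_escape (p r q k j l i : ℕ) (hp : p.Prime) (hr : r.Prime) (hpr : p ≠ r)
    (hqp : q.Coprime p) (hqr : q.Coprime r)
    (hkp : k.Coprime p) (hkr : k.Coprime r) (hj : 1 ≤ j)
    (hpo : ¬ p ∣ orderOf (q : ZMod (p ^ j * r ^ l))) :
    ∃ s : ZMod (p ^ j * r ^ l), ∀ i' : ℕ, (k : ZMod (p ^ j * r ^ l)) * (q : ZMod (p ^ j * r ^ l)) ^ i'
      ≠ (k : ZMod (p ^ j * r ^ l)) * (q : ZMod (p ^ j * r ^ l)) ^ i + s * ((p ^ (j - 1) * r ^ l : ℕ) : ZMod (p ^ j * r ^ l)) := by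
  set n := p ^ j * r ^ l with hn
  have hp0 := hp.pos
  have hr0 := hr.pos
  have hn0 : n ≠ 0 := by positivity
  have : NeZero n := ⟨hn0⟩
  have hnx : n = p * (p ^ (j - 1) * r ^ l) := by
    rw [hn, ← mul_assoc, ← pow_succ', Nat.sub_add_cancel hj]
  have hqn : q.Coprime n := Nat.Coprime.mul_right (hqp.pow_right _) (hqr.pow_right _)
  have hkn : k.Coprime n := Nat.Coprime.mul_right (hkp.pow_right _) (hkr.pow_right _)
  have hqu : IsUnit (q : ZMod n) := (ZMod.isUnit_iff_coprime q n).mpr hqn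
  have hku : IsUnit (k : ZMod n) := (ZMod.isUnit_iff_coprime k n).mpr hkn
  obtain ⟨x, hx⟩ : ∃ x : ZMod n, x = ((p ^ (j - 1) * r ^ l : ℕ) : ZMod n) := ⟨_, rfl⟩
  rw [← hx]
  have hx0 : x ≠ 0 := by
    rw [hx]
    intro h
    rw [ZMod.natCast_eq_zero_iff] at h
    have h1 := Nat.le_of_dvd (by positivity) h
    rw [hnx] at h1
    have h2 : 0 < p ^ (j - 1) * r ^ l := by positivity
    have := hp.two_le
    nlinarith
  have hpx : (p : ZMod n) * x = 0 := by
    rw [hx, ← Nat.cast_mul, ← hnx]; simp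
  rcases Nat.lt_or_ge j 2 with hj2 | hj2
  · obtain rfl : j = 1 := by omega
    have hcop : IsCoprime ((r ^ l : ℕ) : ℤ) ((p : ℕ) : ℤ) :=
      Nat.isCoprime_iff_coprime.mpr (((Nat.coprime_primes hr hp).mpr hpr.symm).pow_left l)
    obtain ⟨a, b, hab⟩ := hcop
    refine ⟨((-(k * q ^ i * a) : ℤ) : ZMod n), fun i' h => ?_⟩
    have hu : IsUnit ((k : ZMod n) * (q : ZMod n) ^ i') := hku.mul (hqu.pow i')
    have hxr : x = ((r ^ l : ℕ) : ZMod n) := by rw [hx]; simp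
    have hab' := congrArg (Int.cast : ℤ → ZMod n) hab
    push_cast at hab'
    have hz : (k : ZMod n) * (q : ZMod n) ^ i' * x = 0 := by
      rw [h]
      push_cast at hxr ⊢
      rw [← hxr] at hab'
      linear_combination (- (k : ZMod n) * (q : ZMod n) ^ i * x) * hab' + (k : ZMod n) * (q : ZMod n) ^ i * b * hpx
    exact hx0 (hu.mul_right_eq_zero.mp hz)
  · refine ⟨1, fun i' h => ?_⟩
    have hxx : x * x = 0 := by
      rw [hx, ← Nat.cast_mul, ZMod.natCast_eq_zero_iff]
      refine ⟨p ^ (j - 2) * r ^ l, ?_⟩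
      obtain ⟨j, rfl⟩ := Nat.exists_eq_add_of_le' hj2
      rw [hn]
      simp only [Nat.add_sub_cancel, show j + 2 - 1 = j + 1 by omega]; ring
    obtain ⟨Q, hQ⟩ := hqu
    obtain ⟨K, hK⟩ := hku
    obtain ⟨w, hw⟩ : ∃ w : ZMod n, w = ((K⁻¹ * (Q ^ i)⁻¹ : (ZMod n)ˣ) : ZMod n) * x := ⟨_, rfl⟩
    have hg : (((Q ^ i)⁻¹ * Q ^ i' : (ZMod n)ˣ) : ZMod n) = 1 + w := by
      have h1 : (K * Q ^ i : (ZMod n)ˣ) * ((((Q ^ i)⁻¹ * Q ^ i' : (ZMod n)ˣ)) : ZMod n)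
          = ((K * Q ^ i : (ZMod n)ˣ) : ZMod n) * (1 + w) := by
        rw [mul_add, hw, ← mul_assoc, ← Units.val_mul, ← Units.val_mul,
          show K * Q ^ i * ((Q ^ i)⁻¹ * Q ^ i') = K * Q ^ i' by group,
          show K * Q ^ i * (K⁻¹ * (Q ^ i)⁻¹) = 1 by
            rw [mul_comm K⁻¹]; group]
        push_cast
        rw [hQ, hK, h]; ring
      exact (Units.mul_right_inj _).mp h1
    have hww : w * w = 0 := by
      rw [hw]; linear_combination (((K⁻¹ * (Q ^ i)⁻¹ : (ZMod n)ˣ) : ZMod n)) ^ 2 * hxx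
    have hpw : (p : ZMod n) * w = 0 := by
      rw [hw]; linear_combination (((K⁻¹ * (Q ^ i)⁻¹ : (ZMod n)ˣ) : ZMod n)) * hpx
    have hg1 : ((Q ^ i)⁻¹ * Q ^ i' : (ZMod n)ˣ) ^ p = 1 := by
      ext
      rw [Units.val_pow_eq_pow_val, hg, aux_pow w hww p, hpw, add_zero, Units.val_one]
    have hQo : Q ^ orderOf (q : ZMod n) = 1 := by
      ext; push_cast; rw [hQ]; exact pow_orderOf_eq_one _
    have hg2 : ((Q ^ i)⁻¹ * Q ^ i' : (ZMod n)ˣ) ^ orderOf (q : ZMod n) = 1 := by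
      rw [mul_pow, inv_pow, ← pow_mul, ← pow_mul, mul_comm i, mul_comm i', pow_mul, pow_mul, hQo]
      simp
    have hg3 : ((Q ^ i)⁻¹ * Q ^ i' : (ZMod n)ˣ) = 1 := by
      rw [← orderOf_eq_one_iff]
      exact Nat.eq_one_of_dvd_coprimes ((Nat.Prime.coprime_iff_not_dvd hp).mpr hpo)
        (orderOf_dvd_of_pow_eq_one hg1) (orderOf_dvd_of_pow_eq_one hg2)
    rw [hg3, hw] at hg
    have : ((K⁻¹ * (Q ^ i)⁻¹ : (ZMod n)ˣ) : ZMod n) * x = 0 := by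
      have h3 : (1 : ZMod n) = 1 + ((K⁻¹ * (Q ^ i)⁻¹ : (ZMod n)ˣ) : ZMod n) * x := by simpa using hg
      linear_combination -h3
    exact hx0 ((Units.mul_right_eq_zero _).mp this)

lemma aux_galois (n o q k : ℕ) (hn : 0 < n) (ζ ζ' : ℂ) (h : IsPrimitiveRoot ζ n)
    (h' : IsPrimitiveRoot ζ' n) (hS : ∑ i ∈ range o, ζ ^ (k * q ^ i) = 0) :
    ∑ i ∈ range o, ζ' ^ (k * q ^ i) = 0 := by
  have h1 : Polynomial.aeval ζ (∑ i ∈ range o, (Polynomial.X : Polynomial ℚ) ^ (k * q ^ i)) = 0 := by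
    simpa using hS
  have h2 := minpoly.dvd ℚ ζ h1
  rw [← Polynomial.cyclotomic_eq_minpoly_rat h hn, Polynomial.cyclotomic_eq_minpoly_rat h' hn] at h2
  have h3 := Polynomial.aeval_eq_zero_of_dvd_aeval_eq_zero h2 (minpoly.aeval ℚ ζ')
  simpa using h3

lemma aux_nonvanish (n q k o : ℕ) [NeZero n] (ho : 0 < o) (x y s t : ZMod n)
    (hxy : ∀ a : ZMod n, IsUnit a ∨ a * x = 0 ∨ a * y = 0)
    (hs : ∀ i, (k : ZMod n) * (q : ZMod n) ^ i ≠ k + s * x)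
    (ht : ∀ i, (k : ZMod n) * (q : ZMod n) ^ i ≠ k + t * y)
    (ζ : ℂ) (hζ : IsPrimitiveRoot ζ n) :
    ∑ i ∈ range o, ζ ^ (k * q ^ i) ≠ 0 := by
  intro hS
  set ψ := AddChar.zmodChar n hζ.pow_eq_one with hψ
  have hprim : ψ.IsPrimitive := AddChar.zmodChar_primitive_of_primitive_root n hζ
  obtain ⟨D, hD⟩ : ∃ D : ZMod n → ℂ, ∀ a, D a =
    ∑ i ∈ range o, ψ (-((k : ZMod n) * (q : ZMod n) ^ i * a)) := ⟨_, fun _ => rfl⟩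
  have hD0 : ∀ a, IsUnit a → D a = 0 := by
    intro a ha
    have hz : IsPrimitiveRoot (ψ (-a)) n := by
      constructor
      · rw [← AddChar.map_nsmul_eq_pow]; simp
      · intro m hm
        rw [← AddChar.map_nsmul_eq_pow] at hm
        have := aux_char hζ _ hm
        rw [nsmul_eq_mul] at this
        have := (ha.neg.mul_left_eq_zero).mp this
        exact (ZMod.natCast_eq_zero_iff _ _).mp this
    have := aux_galois n o q k (NeZero.pos n) ζ _ hζ hz hS
    rw [hD, ← this]
    refine sum_congr rfl fun i _ => ?_
    rw [← AddChar.map_nsmul_eq_pow, nsmul_eq_mul]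
    push_cast; congr 1; ring
  obtain ⟨c, hc⟩ : ∃ c : ZMod n → ℕ, ∀ v, c v =
    #{i ∈ range o | v = (k : ZMod n) * (q : ZMod n) ^ i} := ⟨_, fun _ => rfl⟩
  have hcD : ∀ v, (n : ℂ) * (c v : ℂ) = ∑ a : ZMod n, ψ (a * v) * D a := by
    intro v
    simp_rw [hD, mul_sum]
    rw [sum_comm]
    have : ∀ i, ∑ a : ZMod n, ψ (a * v) * ψ (-((k : ZMod n) * (q : ZMod n) ^ i * a)) =
        if v = (k : ZMod n) * (q : ZMod n) ^ i then (n : ℂ) else 0 := by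
      intro i
      have h1 := AddChar.sum_mulShift (v - (k : ZMod n) * (q : ZMod n) ^ i) hprim
      simp only [sub_eq_zero, ZMod.card] at h1
      rw [Nat.cast_ite, Nat.cast_zero] at h1
      rw [← h1]
      refine sum_congr rfl fun a _ => ?_
      rw [← AddChar.map_add_eq_mul]; congr 1; ring
    simp_rw [this]
    rw [← sum_filter, sum_const, hc, nsmul_eq_mul, mul_comm]
  have hcomb : (n : ℂ) * ((c k : ℂ) - c (k + s * x) - c (k + t * y) + c (k + s * x + t * y)) = 0 := by
    rw [mul_add, mul_sub, mul_sub, hcD, hcD, hcD, hcD, ← sum_sub_distrib, ← sum_sub_distrib,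
      ← sum_add_distrib]
    refine sum_eq_zero fun a _ => ?_
    have hsplit : ψ (a * k) * D a - ψ (a * (k + s * x)) * D a - ψ (a * (k + t * y)) * D a
        + ψ (a * (k + s * x + t * y)) * D a
        = ψ (a * k) * (1 - ψ (s * (a * x))) * (1 - ψ (t * (a * y))) * D a := by
      rw [show a * (k + s * x) = a * k + s * (a * x) by ring,
        show a * (k + t * y) = a * k + t * (a * y) by ring,
        show a * (k + s * x + t * y) = a * k + s * (a * x) + t * (a * y) by ring]
      simp only [AddChar.map_add_eq_mul]; ring
    rw [hsplit]
    rcases hxy a with h | h | h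
    · rw [hD0 a h, mul_zero]
    · rw [h]; simp
    · rw [h]; simp
  have h1 : c (k + s * x) = 0 := by
    rw [hc, card_eq_zero, filter_eq_empty_iff]; exact fun i _ h => hs i h.symm
  have h2 : c (k + t * y) = 0 := by
    rw [hc, card_eq_zero, filter_eq_empty_iff]; exact fun i _ h => ht i h.symm
  have h3 : 0 < c k := by
    rw [hc, card_pos]; exact ⟨0, by simp [ho]⟩
  rw [h1, h2] at hcomb
  have h4 := (mul_eq_zero.mp hcomb).resolve_left (by exact_mod_cast NeZero.ne n)
  have h5 : ((c k + c (k + s * x + t * y) : ℕ) : ℂ) = 0 := by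
    push_cast; simpa using h4
  have h6 : c k + c (k + s * x + t * y) = 0 := by exact_mod_cast h5
  omega

lemma aux_notdvd (p r q j l : ℕ) (hp : p.Prime) (hr : r.Prime) (hpr : p ≠ r)
    (hnd : ¬ p ∣ r - 1) (hqr : q.Coprime r)
    (h : ¬ p ∣ orderOf (q : ZMod (p ^ j))) : ¬ p ∣ orderOf (q : ZMod (p ^ j * r ^ l)) := by
  intro hd
  have h1 : orderOf (q : ZMod (p ^ j * r ^ l)) ∣
      orderOf (q : ZMod (p ^ j)) * orderOf (q : ZMod (r ^ l)) := by
    apply orderOf_dvd_of_pow_eq_one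
    have hc : Nat.Coprime (p ^ j) (r ^ l) := ((Nat.coprime_primes hp hr).mpr hpr).pow _ _
    apply (ZMod.chineseRemainder hc).injective
    rw [map_pow, map_natCast, map_one]
    ext
    · simp [pow_mul, pow_orderOf_eq_one]
    · rw [mul_comm]; simp [pow_mul, pow_orderOf_eq_one]
  rcases hp.dvd_mul.mp (hd.trans h1) with h2 | h2
  · exact h h2
  · have := Nat.eq_one_of_dvd_coprimes (aux_cop p r l hp hr hpr hnd) dvd_rfl
      (h2.trans (aux_order_tot _ _ (hqr.pow_right l)))
    exact hp.one_lt.ne' this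

/-- two-prime vanishing criterion for sums of roots of unity. -/
theorem two_prime_root_of_unity_sum_vanish
    (p₁ p₂ q m ℓ δ₁ δ₂ i01 i02 δ₁' δ₂' : ℕ)
    (hp₁ : p₁.Prime) (hp₂ : p₂.Prime) (hp₁odd : Odd p₁) (hp₂odd : Odd p₂)
    (hlt : p₁ < p₂) (hndvd : ¬ p₁ ∣ (p₂ - 1))
    (hcop : Nat.Coprime q (p₁ * p₂))
    (hm : 1 ≤ m) (hℓ : 1 ≤ ℓ)
    (ho₁ : orderOf ((q : ZMod (p₁ ^ m))) * δ₁ = Nat.totient (p₁ ^ m))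
    (ho₂ : orderOf ((q : ZMod (p₂ ^ ℓ))) * δ₂ = Nat.totient (p₂ ^ ℓ))
    (hi01 : 1 ≤ i01) (hi02 : 1 ≤ i02)
    (hδ₁ : δ₁ = p₁ ^ (i01 - 1) * δ₁') (hδ₂ : δ₂ = p₂ ^ (i02 - 1) * δ₂')
    (hδ₁' : Nat.Coprime δ₁' p₁) (hδ₂' : Nat.Coprime δ₂' p₂) :
    ∀ k : ℕ, Nat.Coprime k (p₁ ^ m * p₂ ^ ℓ) →
    ∀ j₁ j₂ : ℕ, 1 ≤ j₁ → j₁ ≤ m → 1 ≤ j₂ → j₂ ≤ ℓ →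
    ∀ ζ : ℂ, IsPrimitiveRoot ζ (p₁ ^ j₁ * p₂ ^ j₂) →
      ((∑ i ∈ Finset.range (orderOf ((q : ZMod (p₁ ^ j₁ * p₂ ^ j₂)))),
          ζ ^ (k * q ^ i)) = 0 ↔ (i01 < j₁ ∨ i02 < j₂)) := by
  intro k hk j₁ j₂ hj₁ hj₁m hj₂ hj₂l ζ hζ
  have hne : p₁ ≠ p₂ := hlt.ne
  have hnd2 : ¬ p₂ ∣ p₁ - 1 := by
    intro h
    have := hp₁.two_le
    have := Nat.le_of_dvd (by omega) h
    omega
  have hq1 : q.Coprime p₁ := Nat.Coprime.coprime_mul_right_right hcop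
  have hq2 : q.Coprime p₂ := Nat.Coprime.coprime_mul_left_right hcop
  have hk1 : k.Coprime p₁ := by
    have := Nat.Coprime.coprime_mul_right_right hk
    exact (Nat.coprime_pow_right_iff (by omega) _ _).mp this
  have hk2 : k.Coprime p₂ := by
    have := Nat.Coprime.coprime_mul_left_right hk
    exact (Nat.coprime_pow_right_iff (by omega) _ _).mp this
  have A1 := aux_order_p p₁ q m j₁ i01 δ₁ δ₁' hp₁ hp₁odd hq1 hm hj₁ hj₁m hi01 ho₁ hδ₁ hδ₁'
  have A2 := aux_order_p p₂ q ℓ j₂ i02 δ₂ δ₂' hp₂ hp₂odd hq2 hℓ hj₂ hj₂l hi02 ho₂ hδ₂ hδ₂'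
  constructor
  · intro hS
    by_contra hcon
    push Not at hcon
    have B1 := aux_notdvd p₁ p₂ q j₁ j₂ hp₁ hp₂ hne hndvd hq2 (fun h => absurd (A1.mp h) (by omega))
    have B2 := aux_notdvd p₂ p₁ q j₂ j₁ hp₂ hp₁ hne.symm hnd2 hq1
      (fun h => absurd (A2.mp h) (by omega))
    obtain ⟨s, hs⟩ := aux_escape p₁ p₂ q k j₁ j₂ 0 hp₁ hp₂ hne hq1 hq2 hk1 hk2 hj₁ B1
    have C2 := aux_escape p₂ p₁ q k j₂ j₁ 0 hp₂ hp₁ hne.symm hq2 hq1 hk2 hk1 hj₂ B2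
    rw [mul_comm (p₂ ^ j₂) (p₁ ^ j₁)] at C2
    obtain ⟨t, ht⟩ := C2
    have hp10 := hp₁.pos
    have hp20 := hp₂.pos
    have hn0 : p₁ ^ j₁ * p₂ ^ j₂ ≠ 0 := by positivity
    have : NeZero (p₁ ^ j₁ * p₂ ^ j₂) := ⟨hn0⟩
    have hqn : q.Coprime (p₁ ^ j₁ * p₂ ^ j₂) :=
      Nat.Coprime.mul_right (hq1.pow_right _) (hq2.pow_right _)
    refine aux_nonvanish (p₁ ^ j₁ * p₂ ^ j₂) q k _ ?_ _ _ s t ?_ (by simpa using hs)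
      (by simpa using ht) ζ hζ hS
    · exact Nat.pos_of_dvd_of_pos (aux_order_tot _ q hqn)
        (Nat.totient_pos.mpr (Nat.pos_of_ne_zero hn0))
    · intro a
      by_cases h1 : p₁ ∣ a.val
      · right; left
        obtain ⟨b, hb⟩ := h1
        have hab : a = ((p₁ * b : ℕ) : ZMod (p₁ ^ j₁ * p₂ ^ j₂)) := by
          rw [← hb, ZMod.natCast_zmod_val]
        have : ((p₁ * b * (p₁ ^ (j₁ - 1) * p₂ ^ j₂) : ℕ) : ZMod (p₁ ^ j₁ * p₂ ^ j₂)) = 0 := by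
          rw [ZMod.natCast_eq_zero_iff]
          refine ⟨b, ?_⟩
          obtain ⟨j, rfl⟩ := Nat.exists_eq_add_of_le' hj₁
          rw [Nat.add_sub_cancel]; ring
        rw [hab]; push_cast at this ⊢; exact this
      by_cases h2 : p₂ ∣ a.val
      · right; right
        obtain ⟨b, hb⟩ := h2
        have hab : a = ((p₂ * b : ℕ) : ZMod (p₁ ^ j₁ * p₂ ^ j₂)) := by
          rw [← hb, ZMod.natCast_zmod_val]
        have : ((p₂ * b * (p₂ ^ (j₂ - 1) * p₁ ^ j₁) : ℕ) : ZMod (p₁ ^ j₁ * p₂ ^ j₂)) = 0 := by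
          rw [ZMod.natCast_eq_zero_iff]
          refine ⟨b, ?_⟩
          obtain ⟨j, rfl⟩ := Nat.exists_eq_add_of_le' hj₂
          rw [Nat.add_sub_cancel]; ring
        rw [hab]; push_cast at this ⊢; exact this
      left
      rw [← ZMod.natCast_zmod_val a, ZMod.isUnit_iff_coprime]
      exact Nat.Coprime.mul_right
        (((Nat.Prime.coprime_iff_not_dvd hp₁).mpr h1).symm.pow_right _)
        (((Nat.Prime.coprime_iff_not_dvd hp₂).mpr h2).symm.pow_right _)
  · rintro (h | h)
    · exact aux_vanish p₁ p₂ q k j₁ j₂ hp₁ hp₂ hne hp₁odd hndvd hq1 hq2 hk1 hk2 (by omega)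
        ((A1.mpr h).trans (aux_order_dvd _ _ q (Dvd.intro _ rfl))) ζ hζ
    · have := aux_vanish p₂ p₁ q k j₂ j₁ hp₂ hp₁ hne.symm hp₂odd hnd2 hq2 hq1 hk2 hk1 (by omega)
        ((A2.mpr h).trans (aux_order_dvd _ _ q (Dvd.intro _ rfl))) ζ (by rwa [mul_comm])
      rwa [mul_comm (p₂ ^ j₂) (p₁ ^ j₁)] at this
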